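/- arXiv:2412.18001 — 2 statements merged into one kernel-verified Lean document; each statement's English description precedes it below -/
import Mathlib

section
/- For any λ>0 and any point x of G, the largest covered self-inclusive subtree T_λ(x) is the subtree of G induced by the set of all light vertices of x. -/
namespace KCenter

/-- A connected undirected graph network: each vertex `v` has a positive weight `w v`
and each edge `{u,v}` has a positive length `len u v`. -/
structure Net (V : Type) [Fintype V] [DecidableEq V] where
  G : SimpleGraph V
  conn : G.Connected
  w : V → ℝ
  w_pos : ∀ v, 0 < w v
  len : V → V → ℝ
  len_symm : ∀ u v, len u v = len v u
  len_pos : ∀ u v, G.Adj u v → 0 < len u v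

variable {V : Type} [Fintype V] [DecidableEq V]

/-- The length of a walk: the sum of the lengths of its edges. -/
noncomputable def wlen (N : Net V) {u v : V} (p : N.G.Walk u v) : ℝ :=
  (p.edges.map (Sym2.lift ⟨N.len, N.len_symm⟩)).sum

/-- The shortest-path distance between two vertices. -/
noncomputable def dV (N : Net V) (u v : V) : ℝ :=
  sInf {r : ℝ | ∃ p : N.G.Walk u v, wlen N p = r}

/-- A point of the graph: it lies on the edge `e(u,v)` at distance `t` from `u`
(with `0 ≤ t ≤ len u v`). -/
structure Pt (N : Net V) where
  u : V
  v : V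
  adj : N.G.Adj u v
  t : ℝ
  ht0 : 0 ≤ t
  ht1 : t ≤ N.len u v

/-- The length of the edge a point lies on. -/
noncomputable def elen {N : Net V} (x : Pt N) : ℝ := N.len x.u x.v

/-- The shortest-path distance from a point to a vertex. -/
noncomputable def dP (N : Net V) (x : Pt N) (a : V) : ℝ :=
  min (x.t + dV N x.u a) ((elen x - x.t) + dV N x.v a)

/-- `par` encodes a shortest path tree of the point `x`, rooted at the (possibly dummy)
vertex containing `x`: `par a = none` means `a` is attached directly to `x` along the edge
containing `x`, and `par a = some b` means `b` is the tree parent of `a`; in both cases the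
tree path from `x` to `a` is a shortest path. -/
def IsSPT (N : Net V) (x : Pt N) (par : V → Option V) : Prop :=
  ∀ a : V,
    (par a = none →
      (a = x.u ∧ dP N x a = x.t) ∨ (a = x.v ∧ dP N x a = elen x - x.t)) ∧
    (∀ b : V, par a = some b → N.G.Adj b a ∧ dP N x b + N.len b a = dP N x a)

/-- Adjacency in the shortest path tree encoded by `par` (among real vertices). -/
def tAdj (par : V → Option V) (a b : V) : Prop := par a = some b ∨ par b = some a

/-- A set `S` of vertices is connected under the relation `r` using only vertices of `S`. -/
def ConnIn (r : V → V → Prop) (S : Set V) : Prop :=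
  ∀ a ∈ S, ∀ b ∈ S, Relation.ReflTransGen (fun p q => q ∈ S ∧ r p q) a b

/-- `S` is (the vertex set of) a `k`-subtree of a shortest path tree of `x`,
i.e. `S` has `k` vertices and is connected inside some shortest path tree of `x`. -/
def IsKSub (N : Net V) (k : ℕ) (x : Pt N) (S : Set V) : Prop :=
  S.ncard = k ∧ ∃ par : V → Option V, IsSPT N x par ∧ ConnIn (tAdj par) S

/-- `max_{v ∈ S} w v * d(x,v)`. -/
noncomputable def mval (N : Net V) (x : Pt N) (S : Set V) : ℝ :=
  sSup {y : ℝ | ∃ v ∈ S, y = N.w v * dP N x v}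

/-- The set of objective values `max_{v∈T^k} w_v d(x,v)` over all points `x` of `G` and all
`k`-subtrees `T^k` of shortest path trees of `x`; its least element is `λ* = min_x φ(x,G)`. -/
def vals (N : Net V) (k : ℕ) : Set ℝ :=
  {y : ℝ | ∃ (x : Pt N) (S : Set V), IsKSub N k x S ∧ y = mval N x S}

/-- The point `x` is a point of the subtree with vertex set `S`:
it is located at a vertex of `S`, or interior of an edge with both endpoints in `S`. -/
def PtOn (N : Net V) (x : Pt N) (S : Set V) : Prop :=
  (x.t = 0 ∧ x.u ∈ S) ∨ (x.t = elen x ∧ x.v ∈ S) ∨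
  (0 < x.t ∧ x.t < elen x ∧ x.u ∈ S ∧ x.v ∈ S)

/-- `a` is a neutral vertex of `x` (equivalently, `x` is the semicircular point of `a` on
the edge containing `x`). -/
def Neutral (N : Net V) (x : Pt N) (a : V) : Prop :=
  dV N a x.u + x.t = dV N a x.v + (elen x - x.t)

/-- `V_r(x)`: vertices strictly on the `x.u`-side of `x`. -/
def Vr (N : Net V) (x : Pt N) : Set V :=
  {a | dV N a x.u + x.t < dV N a x.v + (elen x - x.t)}

/-- `V_s(x)`: vertices strictly on the `x.v`-side of `x`. -/
def Vs (N : Net V) (x : Pt N) : Set V :=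
  {a | dV N a x.v + (elen x - x.t) < dV N a x.u + x.t}

/-- `V̄(x)`: the set of neutral vertices of `x`. -/
def NbarSet (N : Net V) (x : Pt N) : Set V := {a | Neutral N x a}

/-- `Λ`: the local one-center objective values; for an edge `e(r,s)` and two distinct
vertices `u ≠ v`, the value of an intersection of the increasing branch of `D(u,·)`
with the decreasing branch of `D(v,·)` at a point of `e(r,s)`. -/
def Lam1 (N : Net V) : Set ℝ :=
  {y : ℝ | ∃ r s : V, N.G.Adj r s ∧ ∃ u v : V, u ≠ v ∧ ∃ t : ℝ,
    0 ≤ t ∧ t ≤ N.len r s ∧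
    dV N u r + t ≤ dV N u s + (N.len r s - t) ∧
    dV N v s + (N.len r s - t) ≤ dV N v r + t ∧
    N.w u * (dV N u r + t) = y ∧ N.w v * (dV N v s + (N.len r s - t)) = y}

/-- `Λ'`: the values `w_v · d(v, x')` over all vertices `v` and all semicircular points `x'`
(of any vertex `u`) on edges of `G`. -/
def Lam2 (N : Net V) : Set ℝ :=
  {y : ℝ | ∃ v u r s : V, N.G.Adj r s ∧ ∃ t : ℝ,
    0 ≤ t ∧ t ≤ N.len r s ∧
    dV N u r + t = dV N u s + (N.len r s - t) ∧
    y = N.w v * min (t + dV N r v) ((N.len r s - t) + dV N s v)}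

/-- `S` is (the vertex set of) a `k`-subtree of `G`. -/
def KSubG (N : Net V) (k : ℕ) (S : Set V) : Prop :=
  S.ncard = k ∧ ConnIn N.G.Adj S

/-- The weighted diameter `W(G') = max_{u,v∈V(G')} w_u w_v d(u,v)/(w_u+w_v)`. -/
noncomputable def Wd (N : Net V) (S : Set V) : ℝ :=
  sSup {y : ℝ | ∃ u ∈ S, ∃ v ∈ S, y = N.w u * N.w v * dV N u v / (N.w u + N.w v)}

/-- The subtree with vertex set `S` is covered by the point `x` under `lam`. -/
def Covered (N : Net V) (lam : ℝ) (x : Pt N) (S : Set V) : Prop :=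
  ∀ v ∈ S, N.w v * dP N x v ≤ lam

/-- The vertex `a` is the (real) vertex at which the point `x` is located. -/
def AtX (N : Net V) (x : Pt N) (a : V) : Prop :=
  (x.t = 0 ∧ a = x.u) ∨ (x.t = elen x ∧ a = x.v)

/-- `S` together with `x` induces a connected subtree of the shortest path tree `par` of `x`:
`S` is closed under tree parents, up to the root `x`. -/
def SelfIncl (N : Net V) (x : Pt N) (par : V → Option V) (S : Set V) : Prop :=
  ∀ a ∈ S, ∀ b : V, par a = some b → b ∈ S ∨ AtX N x b

/-- `S` is a covered self-inclusive subtree of `x` under `lam`. -/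
def CSI (N : Net V) (lam : ℝ) (x : Pt N) (S : Set V) : Prop :=
  ∃ par : V → Option V, IsSPT N x par ∧ SelfIncl N x par S ∧ Covered N lam x S

/-- `a` is a heavy vertex of `x`: it cannot be covered by `x` under `lam`. -/
def Heavy (N : Net V) (lam : ℝ) (x : Pt N) (a : V) : Prop := lam < N.w a * dP N x a

/-- The walk `p` (from `a` to an endpoint of the edge containing `x`), extended by the
corresponding segment to `x`, is a shortest path from `a` to `x`. -/
def ShortestToX (N : Net V) (x : Pt N) {a b : V} (p : N.G.Walk a b) : Prop :=
  (b = x.u ∧ wlen N p + x.t = dP N x a) ∨ (b = x.v ∧ wlen N p + (elen x - x.t) = dP N x a)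

/-- `a` is a descendant of the set `S` w.r.t. `x`: every shortest path from `a` to `x`
contains a vertex of `S`. -/
def DescOf (N : Net V) (x : Pt N) (S : Set V) (a : V) : Prop :=
  ∀ (b : V) (p : N.G.Walk a b), ShortestToX N x p → ∃ c ∈ p.support, c ∈ S

/-- `a` is a light vertex of `x`: it is neither heavy nor a descendant of the set of heavy
vertices of `x`. -/
def Light (N : Net V) (lam : ℝ) (x : Pt N) (a : V) : Prop :=
  ¬ Heavy N lam x a ∧ ¬ DescOf N x {c | Heavy N lam x c} a

/-- `f(e,x) = |V(T_λ(x))|`: the maximum cardinality of a covered self-inclusive subtree of `x`. -/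
noncomputable def fval (N : Net V) (lam : ℝ) (x : Pt N) : ℕ :=
  sSup {c : ℕ | ∃ S : Set V, CSI N lam x S ∧ S.ncard = c}

/-- `a` is light by `r = x.u` w.r.t. `x`: it has a shortest path to `x` through the segment
between `r` and `x` that contains no heavy vertex of `x`. -/
def LightByR (N : Net V) (lam : ℝ) (x : Pt N) (a : V) : Prop :=
  ∃ p : N.G.Walk a x.u, wlen N p + x.t = dP N x a ∧ ∀ c ∈ p.support, ¬ Heavy N lam x c

/-- `a` is light by `s = x.v` w.r.t. `x`. -/
def LightByS (N : Net V) (lam : ℝ) (x : Pt N) (a : V) : Prop :=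
  ∃ p : N.G.Walk a x.v, wlen N p + (elen x - x.t) = dP N x a ∧ ∀ c ∈ p.support, ¬ Heavy N lam x c

/-- `Q_r(x)`: the light-by-`r` vertices of `x` in `V_r(x)` together with the neutral vertices
of `x` that are light by `r`. -/
def Qr (N : Net V) (lam : ℝ) (x : Pt N) : Set V :=
  {a | dV N a x.u + x.t ≤ dV N a x.v + (elen x - x.t) ∧ LightByR N lam x a}

/-- `Q_s(x)`: the light-by-`s` vertices of `x` in `V_s(x)` together with the neutral vertices
of `x` that are light by `s`. -/
def Qs (N : Net V) (lam : ℝ) (x : Pt N) : Set V :=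
  {a | dV N a x.v + (elen x - x.t) ≤ dV N a x.u + x.t ∧ LightByS N lam x a}

/-- In a tree, the point `x` lies on the path from the vertex `v` to the vertex `root`. -/
def OnPathToRoot (N : Net V) (root v : V) (x : Pt N) : Prop :=
  dP N x v + dP N x root = dV N v root

/-- `x` is the critical point of the vertex `v` w.r.t. `root`: it lies on the path from `v`
to `root`; it satisfies `w_v · d(v,x) = λ` when this equation has a solution on the path
(i.e. when `λ ≤ w_v · d(v,root)`), and it is the root otherwise. -/
def CritPt (N : Net V) (lam : ℝ) (root v : V) (x : Pt N) : Prop :=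
  OnPathToRoot N root v x ∧
    ((lam ≤ N.w v * dV N v root ∧ N.w v * dP N x v = lam) ∨
     (N.w v * dV N v root < lam ∧ dP N x root = 0))


section

variable (N : Net V)

@[simp]
theorem wlen_nil (a : V) : wlen N (SimpleGraph.Walk.nil : N.G.Walk a a) = 0 := by
  simp [wlen]

@[simp]
theorem wlen_cons {a b c : V} (h : N.G.Adj a b) (p : N.G.Walk b c) :
    wlen N (SimpleGraph.Walk.cons h p) = N.len a b + wlen N p := by
  simp [wlen]

theorem wlen_reverse {a b : V} (p : N.G.Walk a b) : wlen N p.reverse = wlen N p := by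
  simp [wlen]

theorem edgeLength_nonneg {e : Sym2 V} (he : e ∈ N.G.edgeSet) :
    0 ≤ Sym2.lift ⟨N.len, N.len_symm⟩ e := by
  induction e with
  | _ a b => exact (N.len_pos a b he).le

theorem wlen_nonneg {a b : V} (p : N.G.Walk a b) : 0 ≤ wlen N p := by
  refine List.sum_nonneg fun r hr => ?_
  obtain ⟨e, he, rfl⟩ := List.mem_map.1 hr
  exact edgeLength_nonneg N (p.edges_subset_edgeSet he)

theorem wlen_bypass_le {a b : V} (p : N.G.Walk a b) : wlen N p.bypass ≤ wlen N p := by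
  refine (p.edges_bypass_sublist_edges.map _).sum_le_sum fun r hr => ?_
  obtain ⟨e, he, rfl⟩ := List.mem_map.1 hr
  exact edgeLength_nonneg N (p.edges_subset_edgeSet he)

theorem dV_le_wlen {a b : V} (p : N.G.Walk a b) : dV N a b ≤ wlen N p :=
  csInf_le ⟨0, by rintro _ ⟨q, rfl⟩; exact wlen_nonneg N q⟩ ⟨p, rfl⟩

theorem dV_nonneg (a b : V) : 0 ≤ dV N a b :=
  Real.sInf_nonneg (by rintro _ ⟨q, rfl⟩; exact wlen_nonneg N q)

theorem dV_self (a : V) : dV N a a = 0 :=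
  le_antisymm (by simpa using dV_le_wlen N (SimpleGraph.Walk.nil : N.G.Walk a a)) (dV_nonneg N a a)

theorem exists_wlen_eq_dV (a b : V) : ∃ p : N.G.Walk a b, wlen N p = dV N a b := by
  classical
  obtain ⟨w⟩ := N.conn.preconnected a b
  have : Nonempty (N.G.Path a b) := ⟨w.toPath⟩
  obtain ⟨p, hp⟩ := Finite.exists_min fun p : N.G.Path a b => wlen N p.1
  refine ⟨p.1, le_antisymm (le_csInf ⟨_, w, rfl⟩ ?_) (dV_le_wlen N p.1)⟩
  rintro _ ⟨q, rfl⟩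
  exact (hp q.toPath).trans (wlen_bypass_le N q)

variable {N}

theorem dP_le_wlen_left (x : Pt N) {a : V} (p : N.G.Walk a x.u) :
    dP N x a ≤ wlen N p + x.t := by
  have h := dV_le_wlen N p.reverse
  rw [wlen_reverse] at h
  exact (min_le_left _ _).trans (by linarith)

theorem dP_le_wlen_right (x : Pt N) {a : V} (p : N.G.Walk a x.v) :
    dP N x a ≤ wlen N p + (elen x - x.t) := by
  have h := dV_le_wlen N p.reverse
  rw [wlen_reverse] at h
  exact (min_le_right _ _).trans (by linarith)

theorem dP_nonneg (x : Pt N) (a : V) : 0 ≤ dP N x a :=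
  le_min (add_nonneg x.ht0 (dV_nonneg N _ _))
    (add_nonneg (sub_nonneg.2 x.ht1) (dV_nonneg N _ _))

theorem dP_eq_zero_of_atX {x : Pt N} {a : V} (h : AtX N x a) : dP N x a = 0 := by
  refine le_antisymm ?_ (dP_nonneg x a)
  rcases h with ⟨ht, rfl⟩ | ⟨ht, rfl⟩
  · simpa [ht] using dP_le_wlen_left x SimpleGraph.Walk.nil
  · simpa [ht] using dP_le_wlen_right x SimpleGraph.Walk.nil

theorem exists_shortestToX (x : Pt N) (a : V) :
    ∃ (b : V) (p : N.G.Walk a b), ShortestToX N x p := by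
  rcases min_choice (x.t + dV N x.u a) ((elen x - x.t) + dV N x.v a) with h | h
  · obtain ⟨p, hp⟩ := exists_wlen_eq_dV N x.u a
    exact ⟨x.u, p.reverse, .inl ⟨rfl, by rw [wlen_reverse, hp, dP, h, add_comm]⟩⟩
  · obtain ⟨p, hp⟩ := exists_wlen_eq_dV N x.v a
    exact ⟨x.v, p.reverse, .inr ⟨rfl, by rw [wlen_reverse, hp, dP, h, add_comm]⟩⟩

theorem dP_le_add_len (x : Pt N) {a c : V} (h : N.G.Adj a c) :
    dP N x a ≤ dP N x c + N.len a c := by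
  obtain ⟨b, p, ⟨rfl, hp⟩ | ⟨rfl, hp⟩⟩ := exists_shortestToX x c
  · have := dP_le_wlen_left x (p.cons h)
    rw [wlen_cons] at this
    linarith
  · have := dP_le_wlen_right x (p.cons h)
    rw [wlen_cons] at this
    linarith

theorem ShortestToX.of_cons {x : Pt N} {a b c : V} {h : N.G.Adj a c} {p : N.G.Walk c b}
    (hp : ShortestToX N x (p.cons h)) :
    ShortestToX N x p ∧ dP N x c + N.len c a = dP N x a := by
  have hle := dP_le_add_len x h
  rw [N.len_symm c a]
  obtain ⟨rfl, hp⟩ | ⟨rfl, hp⟩ := hp <;> rw [wlen_cons] at hp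
  · have := dP_le_wlen_left x p
    exact ⟨.inl ⟨rfl, by linarith⟩, by linarith⟩
  · have := dP_le_wlen_right x p
    exact ⟨.inr ⟨rfl, by linarith⟩, by linarith⟩

theorem ShortestToX.cons {x : Pt N} {a b c : V} {p : N.G.Walk c b}
    (hp : ShortestToX N x p) (h : N.G.Adj a c) (hd : dP N x c + N.len c a = dP N x a) :
    ShortestToX N x (p.cons h) := by
  rw [N.len_symm c a] at hd
  obtain ⟨hb, hp⟩ | ⟨hb, hp⟩ := hp
  · exact .inl ⟨hb, by rw [wlen_cons]; linarith⟩
  · exact .inr ⟨hb, by rw [wlen_cons]; linarith⟩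

theorem shortestToX_nil_iff {x : Pt N} {a : V} :
    ShortestToX N x (SimpleGraph.Walk.nil : N.G.Walk a a) ↔
      (a = x.u ∧ dP N x a = x.t) ∨ (a = x.v ∧ dP N x a = elen x - x.t) := by
  simp [ShortestToX, eq_comm]

theorem shortestToX_nil_of_atX {x : Pt N} {a : V} (h : AtX N x a) :
    ShortestToX N x (SimpleGraph.Walk.nil : N.G.Walk a a) := by
  rw [shortestToX_nil_iff, dP_eq_zero_of_atX h]
  rcases h with ⟨ht, ha⟩ | ⟨ht, ha⟩
  · exact .inl ⟨ha, ht.symm⟩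
  · exact .inr ⟨ha, by rw [ht, sub_self]⟩

theorem not_heavy_of_atX {lam : ℝ} (hlam : 0 < lam) {x : Pt N} {a : V} (h : AtX N x a) :
    ¬ Heavy N lam x a := by
  simpa [Heavy, dP_eq_zero_of_atX h] using hlam.le

theorem light_iff {lam : ℝ} {x : Pt N} {a : V} :
    Light N lam x a ↔
      ∃ (b : V) (p : N.G.Walk a b), ShortestToX N x p ∧ ∀ c ∈ p.support, ¬ Heavy N lam x c := by
  constructor
  · rintro ⟨-, h⟩
    simpa [DescOf] using h
  · rintro ⟨b, p, hp, hl⟩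
    refine ⟨hl a p.start_mem_support, fun h => ?_⟩
    obtain ⟨c, hc, hch⟩ := h b p hp
    exact hl c hc hch

theorem light_of_atX {lam : ℝ} (hlam : 0 < lam) {x : Pt N} {a : V} (h : AtX N x a) :
    Light N lam x a :=
  light_iff.2 ⟨a, .nil, shortestToX_nil_of_atX h, by simpa using not_heavy_of_atX hlam h⟩

theorem Light.of_parent {lam : ℝ} {x : Pt N} {a b : V} (hb : Light N lam x b)
    (ha : ¬ Heavy N lam x a) (h : N.G.Adj b a) (hd : dP N x b + N.len b a = dP N x a) :
    Light N lam x a := by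
  obtain ⟨c, p, hp, hl⟩ := light_iff.1 hb
  exact light_iff.2 ⟨c, p.cons h.symm, hp.cons h.symm hd, by simpa using ⟨ha, hl⟩⟩

/-- The first step of a shortest walk from `a` to `x` provides a tree parent of `a`;
for a light vertex it may be chosen light. -/
theorem exists_parent (lam : ℝ) (x : Pt N) (a : V) :
    ∃ o : Option V,
      (o = none → (a = x.u ∧ dP N x a = x.t) ∨ (a = x.v ∧ dP N x a = elen x - x.t)) ∧
      (∀ b : V, o = some b → N.G.Adj b a ∧ dP N x b + N.len b a = dP N x a) ∧
      (Light N lam x a → ∀ b : V, o = some b → Light N lam x b) := by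
  obtain ⟨b, p, hp, hl⟩ : ∃ (b : V) (p : N.G.Walk a b), ShortestToX N x p ∧
      (Light N lam x a → ∀ c ∈ p.support, ¬ Heavy N lam x c) := by
    by_cases ha : Light N lam x a
    · obtain ⟨b, p, hp, hl⟩ := light_iff.1 ha
      exact ⟨b, p, hp, fun _ => hl⟩
    · obtain ⟨b, p, hp⟩ := exists_shortestToX x a
      exact ⟨b, p, hp, fun h => absurd h ha⟩
  cases p with
  | nil => exact ⟨none, fun _ => shortestToX_nil_iff.1 hp, by simp, by simp⟩
  | @cons _ c _ h q =>
    obtain ⟨hq, hd⟩ := hp.of_cons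
    refine ⟨some c, by simp, ?_, ?_⟩
    · rintro _ ⟨⟩
      exact ⟨h.symm, hd⟩
    · rintro ha _ ⟨⟩
      exact light_iff.2 ⟨b, q, hq, fun d hd => hl ha d (List.mem_cons_of_mem _ hd)⟩

theorem csi_setOf_light (lam : ℝ) (x : Pt N) : CSI N lam x {a | Light N lam x a} := by
  choose par hnone hsome hlight using exists_parent lam x
  exact ⟨par, fun a => ⟨hnone a, hsome a⟩, fun a ha b hb => .inl (hlight a ha b hb),
    fun a ha => not_lt.1 ha.1⟩

theorem CSI.subset_setOf_light {lam : ℝ} (hlam : 0 < lam) {x : Pt N} {S : Set V}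
    (hS : CSI N lam x S) : S ⊆ {a | Light N lam x a} := by
  obtain ⟨par, hpar, hself, hcov⟩ := hS
  have hwf : WellFounded fun a b : V => dP N x a < dP N x b :=
    have : IsTrans V fun a b => dP N x a < dP N x b := ⟨fun _ _ _ => lt_trans⟩
    have : Std.Irrefl fun a b : V => dP N x a < dP N x b := ⟨fun _ => lt_irrefl _⟩
    Finite.wellFounded_of_trans_of_irrefl _
  intro a
  induction a using hwf.induction with
  | _ a ih =>
    intro ha
    have hna : ¬ Heavy N lam x a := not_lt.2 (hcov a ha)
    cases hp : par a with
    | none =>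
      exact light_iff.2 ⟨a, .nil, shortestToX_nil_iff.2 ((hpar a).1 hp), by simpa using hna⟩
    | some b =>
      obtain ⟨hadj, hd⟩ := (hpar a).2 b hp
      refine Light.of_parent ?_ hna hadj hd
      rcases hself a ha b hp with hb | hb
      · exact ih b (by linarith [N.len_pos b a hadj]) hb
      · exact light_of_atX hlam hb

end

/-- For any `λ > 0` and any point `x` of `G`, the largest covered
self-inclusive subtree `T_λ(x)` is the subtree of `G` induced by the set of all light
vertices of `x`: the set of light vertices is itself a covered self-inclusive subtree of
`x`, and every covered self-inclusive subtree of `x` consists only of light vertices. -/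
theorem stmt11 {V : Type} [Fintype V] [DecidableEq V] (N : Net V)
    (lam : ℝ) (hlam : 0 < lam) (x : Pt N) :
    CSI N lam x {a | Light N lam x a} ∧
      ∀ S : Set V, CSI N lam x S → S ⊆ {a | Light N lam x a} := by
  exact ⟨csi_setOf_light lam x, fun _ hS => hS.subset_setOf_light hlam⟩

end KCenter
end

section
/- Let C be a set of n x-monotone polygonal chains over the interval [0,l], each chain being either a single line segment of slope +1 or −1, or a segment of slope +1 followed by a segment of slope −1. On the generalized k-th level C^k of C, segments of slope +1 and slope −1 alternate, and for any segment of slope +1 (resp. −1) on C^k, the x-intercept of its supporting line is smaller than the x-intercept of the supporting line of every succeeding segment of slope +1 (resp. −1) on C^k. -/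
namespace KLevelGeom

/-- A chain: the graph over `x` of `min (a + x) (b - x)`.  On an interval `[0,l]`, such a
function is exactly an `x`-monotone polygonal chain that is either a single segment of
slope `+1`, a single segment of slope `−1`, or a segment of slope `+1` followed by a
segment of slope `−1`. -/
noncomputable def chain (a b x : ℝ) : ℝ := min (a + x) (b - x)

/-- The number of chains of the family `f` that are not above the point `(x, y)`,
i.e. the number of chains intersected by the downward-directed vertical ray from `(x,y)`
(together with the chains through `(x,y)` itself). -/
noncomputable def belowCount (n : ℕ) (f : Fin n → ℝ → ℝ) (x y : ℝ) : ℕ :=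
  {i : Fin n | f i x ≤ y}.ncard

/-- The generalized `k`-th level of the family of chains `f` over `[0,l]`: the closure of
the set of all points lying on chains such that the downward-directed vertical ray
emanating from the point meets the fewest possible but at least `k` chains. -/
noncomputable def KLevel (n k : ℕ) (l : ℝ) (f : Fin n → ℝ → ℝ) : Set (ℝ × ℝ) :=
  closure {p : ℝ × ℝ | p.1 ∈ Set.Icc 0 l ∧ (∃ i, f i p.1 = p.2) ∧
    k ≤ belowCount n f p.1 p.2 ∧
    ∀ y' : ℝ, (∃ i, f i p.1 = y') → k ≤ belowCount n f p.1 y' →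
      belowCount n f p.1 p.2 ≤ belowCount n f p.1 y'}

/-- The slope of a segment: `+1` if `σ = true`, `−1` if `σ = false`. -/
noncomputable def slope (σ : Bool) : ℝ := if σ then 1 else -1

/-- The `x`-intercept of the supporting line `y = slope σ * x + c` of a segment. -/
noncomputable def xIntercept (σ : Bool) (c : ℝ) : ℝ := if σ then -c else c

/-- `g` is affine of slope `σ` with intercept `c` on `[u, v]`. -/
def IsAffineOn (g : ℝ → ℝ) (u v : ℝ) (σ : Bool) (c : ℝ) : Prop :=
  ∀ x ∈ Set.Icc u v, g x = slope σ * x + c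

/-- On `[u, v]` the graph of `g` consists of finitely many segments with alternating slopes
`+1` and `-1`. -/
def IsZigzag (g : ℝ → ℝ) (u v : ℝ) : Prop :=
  ∃ m : ℕ, 1 ≤ m ∧ ∃ (ξ c : ℕ → ℝ) (σ : ℕ → Bool),
    ξ 0 = u ∧ ξ m = v ∧ (∀ j < m, ξ j < ξ (j + 1)) ∧
    (∀ j < m, IsAffineOn g (ξ j) (ξ (j + 1)) (σ j) (c j)) ∧
    ∀ j, j + 1 < m → σ (j + 1) ≠ σ j

theorem IsAffineOn.isZigzag {g : ℝ → ℝ} {u v c : ℝ} {σ : Bool} (huv : u < v)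
    (h : IsAffineOn g u v σ c) : IsZigzag g u v := by
  refine ⟨1, le_rfl, fun j => if j = 0 then u else v, fun _ => c, fun _ => σ, by simp, by simp,
    ?_, ?_, ?_⟩
  · intro j hj
    obtain rfl : j = 0 := by omega
    simpa using huv
  · intro j hj
    obtain rfl : j = 0 := by omega
    simpa using h
  · intro j hj
    omega

theorem IsAffineOn.trans {g : ℝ → ℝ} {u t v c d : ℝ} {σ : Bool} (hut : u ≤ t) (htv : t ≤ v)
    (h₁ : IsAffineOn g u t σ c) (h₂ : IsAffineOn g t v σ d) : IsAffineOn g u v σ d := by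
  intro x hx
  have e₁ := h₁ t ⟨hut, le_rfl⟩
  have e₂ := h₂ t ⟨le_rfl, htv⟩
  rcases le_total x t with hxt | hxt
  · have := h₁ x ⟨hx.1, hxt⟩
    linarith
  · exact h₂ x ⟨hxt, hx.2⟩

/-- Prepending an affine piece to a zigzag gives a zigzag. -/
theorem IsZigzag.prepend {g : ℝ → ℝ} {u t v c₀ : ℝ} {σ₀ : Bool} (hut : u < t)
    (h₀ : IsAffineOn g u t σ₀ c₀) (h : IsZigzag g t v) : IsZigzag g u v := by
  obtain ⟨m, hm, ξ, c, σ, hξ0, hξm, hlt, haff, halt⟩ := h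
  by_cases hσ : σ 0 = σ₀
  · refine ⟨m, hm, Function.update ξ 0 u, c, σ, by simp, ?_, ?_, ?_, halt⟩
    · rw [Function.update_of_ne (by omega), hξm]
    · rintro (_ | j) hj
      · have := hlt 0 hj
        simp only [Function.update_self]
        rw [Function.update_of_ne (by omega)]
        linarith
      · rw [Function.update_of_ne (by omega), Function.update_of_ne (by omega)]
        exact hlt _ hj
    · rintro (_ | j) hj
      · have := hlt 0 hj
        simp only [Function.update_self]
        rw [Function.update_of_ne (by omega)]
        have h1 := haff 0 hj
        rw [hξ0] at h1 this
        subst hσ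
        exact h₀.trans hut.le this.le h1
      · rw [Function.update_of_ne (by omega), Function.update_of_ne (by omega)]
        exact haff _ hj
  · refine ⟨m + 1, by omega, fun j => Nat.casesOn j u ξ, fun j => Nat.casesOn j c₀ c,
      fun j => Nat.casesOn j σ₀ σ, rfl, hξm, ?_, ?_, ?_⟩
    · rintro (_ | j) hj
      · simpa [hξ0] using hut
      · exact hlt j (by omega)
    · rintro (_ | j) hj
      · simpa [hξ0] using h₀
      · exact haff j (by omega)
    · rintro (_ | j) hj
      · exact hσ
      · exact halt j (by omega)

/-- A function that is affine of slope `±1` away from a finite set of breakpoints is a zigzag. -/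
theorem isZigzag_of_finset {g : ℝ → ℝ} (T : Finset ℝ)
    (hT : ∀ u v, u < v → (∀ t ∈ T, t ∉ Set.Ioo u v) → ∃ σ c, IsAffineOn g u v σ c)
    {u v : ℝ} (huv : u < v) : IsZigzag g u v := by
  classical
  induction hN : (T.filter (· ∈ Set.Ioo u v)).card using Nat.strong_induction_on generalizing u with
  | _ N ih =>
    rcases (T.filter (· ∈ Set.Ioo u v)).eq_empty_or_nonempty with he | hne
    · obtain ⟨σ, c, h⟩ := hT u v huv fun t ht htI =>
        Finset.notMem_empty t (he ▸ Finset.mem_filter.2 ⟨ht, htI⟩)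
      exact h.isZigzag huv
    · obtain ⟨t, ht, hmin⟩ := Finset.exists_min_image _ id hne
      have htI := (Finset.mem_filter.1 ht).2
      obtain ⟨σ, c, h⟩ := hT u t htI.1 fun s hs hsI => by
        have := hmin s (Finset.mem_filter.2 ⟨hs, hsI.1, hsI.2.trans htI.2⟩)
        exact absurd hsI.2 (not_lt.2 this)
      refine IsZigzag.prepend htI.1 h (ih _ ?_ htI.2 rfl)
      rw [← hN]
      refine Finset.card_lt_card ⟨fun s hs => ?_, fun hsub => ?_⟩
      · obtain ⟨hs, hsI⟩ := Finset.mem_filter.1 hs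
        exact Finset.mem_filter.2 ⟨hs, htI.1.trans hsI.1, hsI.2⟩
      · exact lt_irrefl t (Finset.mem_filter.1 (hsub ht)).2.1

/-- A continuous function whose graph is covered by finitely many parallel lines over an
open interval follows a single line there. -/
theorem exists_eq_on_of_parallel {n : ℕ} {g : ℝ → ℝ} (hg : Continuous g) (s : ℝ) (d : Fin n → ℝ)
    {u v : ℝ} (h : ∀ x ∈ Set.Ioo u v, ∃ i, g x = s * x + d i) :
    ∃ c, ∀ x ∈ Set.Ioo u v, g x = s * x + c := by
  rcases (Set.Ioo u v).eq_empty_or_nonempty with he | ⟨y, hy⟩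
  · exact ⟨0, by simp [he]⟩
  · refine ⟨g y - s * y, fun x hx => ?_⟩
    have hmaps : Set.MapsTo (fun x => g x - s * x) (Set.Ioo u v) (Set.range d) := by
      intro x hx
      obtain ⟨i, hi⟩ := h x hx
      exact ⟨i, by simp [hi]⟩
    have := isPreconnected_Ioo.constant_of_mapsTo
      (f := fun x => g x - s * x) (Set.finite_range d).isDiscrete (by fun_prop) hmaps hx hy
    linarith

/-- Between crossings of the lines of slope `+1` with those of slope `-1`, a continuous function
whose graph is covered by these lines is affine. -/
theorem exists_isAffineOn {n : ℕ} {g : ℝ → ℝ} (hg : Continuous g) (a b : Fin n → ℝ)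
    (hcov : ∀ x, ∃ i, g x = a i + x ∨ g x = b i - x) {u v : ℝ} (huv : u < v)
    (hT : ∀ i j, (b j - a i) / 2 ∉ Set.Ioo u v) : ∃ σ c, IsAffineOn g u v σ c := by
  set P : Set ℝ := ⋃ i, {x | g x = a i + x} with hP
  set M : Set ℝ := ⋃ i, {x | g x = b i - x} with hM
  have hPc : IsClosed P :=
    isClosed_iUnion_of_finite fun i => isClosed_eq hg (by fun_prop)
  have hMc : IsClosed M :=
    isClosed_iUnion_of_finite fun i => isClosed_eq hg (by fun_prop)
  have hPM : Set.Ioo u v ⊆ P ∪ M := by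
    intro x _
    obtain ⟨i, hi | hi⟩ := hcov x
    · exact Or.inl (Set.mem_iUnion.2 ⟨i, hi⟩)
    · exact Or.inr (Set.mem_iUnion.2 ⟨i, hi⟩)
  have hdisj : Set.Ioo u v ∩ (P ∩ M) = ∅ := by
    refine Set.eq_empty_of_forall_notMem ?_
    rintro x ⟨hx, hxP, hxM⟩
    obtain ⟨i, hi⟩ := Set.mem_iUnion.1 hxP
    obtain ⟨j, hj⟩ := Set.mem_iUnion.1 hxM
    simp only [Set.mem_ofPred_eq] at hi hj
    refine hT i j ?_
    rwa [show (b j - a i) / 2 = x by linarith]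
  have key : ∃ σ c, ∀ x ∈ Set.Ioo u v, g x = slope σ * x + c := by
    rcases isPreconnected_iff_subset_of_disjoint_closed.1 isPreconnected_Ioo P M hPc hMc hPM hdisj
      with h | h
    · refine ⟨true, exists_eq_on_of_parallel hg _ a fun x hx => ?_⟩
      obtain ⟨i, hi⟩ := Set.mem_iUnion.1 (h hx)
      simp only [Set.mem_ofPred_eq] at hi
      exact ⟨i, by rw [hi]; simp [slope]; ring⟩
    · refine ⟨false, exists_eq_on_of_parallel hg _ b fun x hx => ?_⟩
      obtain ⟨i, hi⟩ := Set.mem_iUnion.1 (h hx)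
      simp only [Set.mem_ofPred_eq] at hi
      exact ⟨i, by rw [hi]; simp [slope]; ring⟩
  obtain ⟨σ, c, h⟩ := key
  refine ⟨σ, c, fun x hx => ?_⟩
  have hcl : IsClosed {x | g x = slope σ * x + c} := isClosed_eq hg (by fun_prop)
  have := closure_minimal (show Set.Ioo u v ⊆ _ from h) hcl
  rw [closure_Ioo huv.ne] at this
  exact this hx

theorem belowCount_mono {n : ℕ} (f : Fin n → ℝ → ℝ) (x : ℝ) : Monotone (belowCount n f x) :=
  fun _ _ hyz => Set.ncard_le_ncard (fun _ hi => le_trans hi hyz) (Set.toFinite _)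

theorem exists_le_of_le_belowCount {n k : ℕ} (hk : 1 ≤ k) (f : Fin n → ℝ → ℝ) {x y : ℝ}
    (h : k ≤ belowCount n f x y) : ∃ i, f i x ≤ y ∧ k ≤ belowCount n f x (f i x) := by
  have hne : {i : Fin n | f i x ≤ y}.Nonempty :=
    Set.nonempty_of_ncard_ne_zero (by unfold belowCount at h; omega)
  obtain ⟨i, hi, hmax⟩ := Set.exists_max_image _ (fun i => f i x) (Set.toFinite _) hne
  exact ⟨i, hi, h.trans (Set.ncard_le_ncard (fun j hj => hmax j hj) (Set.toFinite _))⟩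

/-- The `k`-th smallest value of the family `f` at `x`. -/
theorem exists_level {n k : ℕ} (hk : 1 ≤ k) (hkn : k ≤ n) (f : Fin n → ℝ → ℝ) (x : ℝ) :
    ∃ g : ℝ, (∃ i, f i x = g) ∧ ∀ y, k ≤ belowCount n f x y ↔ g ≤ y := by
  obtain ⟨B, hB⟩ := (Set.finite_range fun i => f i x).bddAbove
  have hBk : k ≤ belowCount n f x B := by
    have : {i : Fin n | f i x ≤ B} = Set.univ :=
      Set.eq_univ_of_forall fun i => hB ⟨i, rfl⟩
    simpa [belowCount, this, Set.ncard_univ] using hkn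
  obtain ⟨i₁, -, hi₁⟩ := exists_le_of_le_belowCount hk f hBk
  obtain ⟨i, hi, hmin⟩ := Set.exists_min_image {i | k ≤ belowCount n f x (f i x)}
    (fun i => f i x) (Set.toFinite _) ⟨i₁, hi₁⟩
  refine ⟨f i x, ⟨i, rfl⟩, fun y => ⟨fun h => ?_, fun h => le_trans hi (belowCount_mono f x h)⟩⟩
  obtain ⟨j, hj, hjk⟩ := exists_le_of_le_belowCount hk f h
  exact (hmin j hjk).trans hj

theorem continuous_level {n k : ℕ} (f : Fin n → ℝ → ℝ)
    (hf : ∀ i x y, f i y ≤ f i x + |y - x|) (g : ℝ → ℝ)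
    (hg : ∀ x y, k ≤ belowCount n f x y ↔ g x ≤ y) : Continuous g := by
  refine (LipschitzWith.of_le_add fun x y => ?_).continuous
  rw [← hg, Real.dist_eq]
  refine ((hg y (g y)).2 le_rfl).trans (Set.ncard_le_ncard (fun i hi => ?_) (Set.toFinite _))
  exact (hf i y x).trans (add_le_add_left hi _)

theorem chain_le_add_abs (a b x y : ℝ) : chain a b y ≤ chain a b x + |y - x| := by
  have h₁ := le_abs_self (y - x)
  have h₂ := neg_abs_le (y - x)
  unfold chain
  rw [← min_add_add_right]
  exact min_le_min (by linarith) (by linarith)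

theorem kLevel_eq_graph {n k : ℕ} {l : ℝ} (f : Fin n → ℝ → ℝ) {g : ℝ → ℝ} (hcont : Continuous g)
    (hmem : ∀ x, ∃ i, f i x = g x) (hg : ∀ x y, k ≤ belowCount n f x y ↔ g x ≤ y) :
    KLevel n k l f = {p : ℝ × ℝ | p.1 ∈ Set.Icc 0 l ∧ p.2 = g p.1} := by
  have hcl : IsClosed {p : ℝ × ℝ | p.1 ∈ Set.Icc 0 l ∧ p.2 = g p.1} :=
    (isClosed_Icc.preimage continuous_fst).inter (isClosed_eq continuous_snd (by fun_prop))
  rw [← hcl.closure_eq]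
  unfold KLevel
  congr 1
  ext ⟨x, y⟩
  refine and_congr_right fun _ => ⟨?_, ?_⟩
  · rintro ⟨⟨i, hi⟩, hk, hmin⟩
    simp only at hi hk hmin ⊢
    refine le_antisymm (not_lt.1 fun hlt => ?_) ((hg x y).1 hk)
    refine absurd (hmin (g x) (hmem x) ((hg x _).2 le_rfl)) (not_le.2 ?_)
    refine Set.ncard_lt_ncard ⟨fun j hj => le_trans hj hlt.le, fun hsub => ?_⟩ (Set.toFinite _)
    have : f i x ≤ g x := hsub (show f i x ≤ y from hi.le)
    linarith
  · rintro h
    simp only at h ⊢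
    subst h
    exact ⟨hmem x, (hg x _).2 le_rfl, fun y' _ hy' => belowCount_mono f x ((hg x y').1 hy')⟩

theorem exists_mem_Icc_of_chain {m : ℕ} {ξ : ℕ → ℝ} {x : ℝ} (hm : 1 ≤ m)
    (hx : x ∈ Set.Icc (ξ 0) (ξ m)) : ∃ j < m, x ∈ Set.Icc (ξ j) (ξ (j + 1)) := by
  induction m, hm using Nat.le_induction with
  | base => exact ⟨0, one_pos, hx⟩
  | succ m _ ih =>
    rcases le_total x (ξ m) with h | h
    · obtain ⟨j, hj, hxj⟩ := ih ⟨hx.1, h⟩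
      exact ⟨j, by omega, hxj⟩
    · exact ⟨m, by omega, h, hx.2⟩

theorem le_of_forall_le_succ {m : ℕ} {h : ℕ → ℝ} (hh : ∀ j < m, h j ≤ h (j + 1)) {i j : ℕ}
    (hij : i ≤ j) (hj : j ≤ m) : h i ≤ h j := by
  induction j, hij using Nat.le_induction with
  | base => exact le_rfl
  | succ j _ ih => exact (ih (by omega)).trans (hh j (by omega))

theorem xIntercept_eq (σ : Bool) (x y c : ℝ) (h : y = slope σ * x + c) :
    xIntercept σ c = x - slope σ * y := by
  cases σ <;> simp [slope, xIntercept] at * <;> linarith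

theorem xIntercept_lt {g : ℝ → ℝ} {m : ℕ} {ξ c : ℕ → ℝ} {σ : ℕ → Bool}
    (hlt : ∀ j < m, ξ j < ξ (j + 1))
    (haff : ∀ j < m, IsAffineOn g (ξ j) (ξ (j + 1)) (σ j) (c j))
    (halt : ∀ j, j + 1 < m → σ (j + 1) ≠ σ j) {i j : ℕ} (hij : i < j) (hj : j < m)
    (hσ : σ i = σ j) : xIntercept (σ i) (c i) < xIntercept (σ j) (c j) := by
  have hl : ∀ q < m, g (ξ q) = slope (σ q) * ξ q + c q := fun q hq =>
    haff q hq _ ⟨le_rfl, (hlt q hq).le⟩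
  have hr : ∀ q < m, g (ξ (q + 1)) = slope (σ q) * ξ (q + 1) + c q := fun q hq =>
    haff q hq _ ⟨(hlt q hq).le, le_rfl⟩
  rw [xIntercept_eq _ _ _ _ (hl i (by omega)), xIntercept_eq _ _ _ _ (hl j hj), ← hσ]
  set s := σ i with hs
  have hstep : ∀ q < m, ξ q - slope s * g (ξ q) ≤ ξ (q + 1) - slope s * g (ξ (q + 1)) := by
    intro q hq
    have h₀ := hlt q hq
    rw [hl q hq, hr q hq]
    cases s <;> cases σ q <;> simp [slope] <;> linarith
  have hne : σ (i + 1) ≠ s := halt i (by omega)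
  have hij' : i + 1 < j := lt_of_le_of_ne hij fun h => hne (h ▸ hσ.symm)
  have hstrict : ξ (i + 1) - slope s * g (ξ (i + 1)) <
      ξ (i + 1 + 1) - slope s * g (ξ (i + 1 + 1)) := by
    have h₀ := hlt (i + 1) (by omega)
    rw [hl (i + 1) (by omega), hr (i + 1) (by omega)]
    revert hne
    cases s <;> cases σ (i + 1) <;> simp [slope] <;> linarith
  exact (hstep i (by omega)).trans_lt (hstrict.trans_le
    (le_of_forall_le_succ (h := fun q => ξ q - slope s * g (ξ q)) hstep hij' hj.le))

/-- Let `C` be a set of `n` `x`-monotone polygonal chains over `[0,l]`,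
each chain being either a single line segment of slope `+1` or `−1`, or a segment of
slope `+1` followed by a segment of slope `−1`.  On the generalized `k`-th level `C^k`
of `C`, segments of slope `+1` and slope `−1` alternate, and for any segment of slope
`+1` (resp. `−1`) on `C^k`, the `x`-intercept of its supporting line is smaller than the
`x`-intercept of the supporting line of every succeeding segment of slope `+1`
(resp. `−1`) on `C^k`. -/
theorem stmt16 (n k : ℕ) (hk : 1 ≤ k) (hkn : k ≤ n) (l : ℝ) (hl : 0 < l)
    (a b : Fin n → ℝ) :
    ∃ m : ℕ, 1 ≤ m ∧
      ∃ (ξ c : ℕ → ℝ) (σ : ℕ → Bool),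
        ξ 0 = 0 ∧ ξ m = l ∧ (∀ j < m, ξ j < ξ (j + 1)) ∧
        (∀ j : ℕ, j + 1 < m →
          slope (σ j) * ξ (j + 1) + c j = slope (σ (j + 1)) * ξ (j + 1) + c (j + 1)) ∧
        (KLevel n k l (fun i x => chain (a i) (b i) x) =
          ⋃ j ∈ Finset.range m,
            {p : ℝ × ℝ | p.1 ∈ Set.Icc (ξ j) (ξ (j + 1)) ∧ p.2 = slope (σ j) * p.1 + c j}) ∧
        (∀ j : ℕ, j + 1 < m → σ (j + 1) ≠ σ j) ∧
        (∀ i j : ℕ, i < j → j < m → σ i = σ j →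
          xIntercept (σ i) (c i) < xIntercept (σ j) (c j)) := by
  choose g hmem hg using exists_level hk hkn fun i x => chain (a i) (b i) x
  have hcont : Continuous g :=
    continuous_level _ (fun i x y => chain_le_add_abs (a i) (b i) x y) g hg
  have hcov : ∀ x, ∃ i, g x = a i + x ∨ g x = b i - x := fun x => by
    obtain ⟨i, hi⟩ := hmem x
    exact ⟨i, hi ▸ min_choice _ _⟩
  have hz : IsZigzag g 0 l := by
    refine isZigzag_of_finset (Finset.univ.image fun p : Fin n × Fin n => (b p.2 - a p.1) / 2)
      (fun u v huv hT => exists_isAffineOn hcont a b hcov huv fun i j => hT _ ?_) hl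
    exact Finset.mem_image.2 ⟨(i, j), Finset.mem_univ _, rfl⟩
  obtain ⟨m, hm, ξ, c, σ, hξ0, hξm, hlt, haff, halt⟩ := hz
  refine ⟨m, hm, ξ, c, σ, hξ0, hξm, hlt, fun j hj => ?_, ?_, halt,
    fun i j hij hj hσ => xIntercept_lt hlt haff halt hij hj hσ⟩
  · rw [← haff j (by omega) _ ⟨(hlt j (by omega)).le, le_rfl⟩,
      ← haff (j + 1) hj _ ⟨le_rfl, (hlt _ hj).le⟩]
  · rw [kLevel_eq_graph _ hcont hmem hg]
    ext ⟨x, y⟩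
    simp only [Set.mem_ofPred_eq, Set.mem_iUnion, Finset.mem_range, exists_prop]
    constructor
    · rintro ⟨hx, rfl⟩
      obtain ⟨j, hj, hxj⟩ := exists_mem_Icc_of_chain (ξ := ξ) hm (by rwa [hξ0, hξm])
      exact ⟨j, hj, hxj, haff j hj x hxj⟩
    · rintro ⟨j, hj, hxj, rfl⟩
      have hle : ∀ q < m, ξ q ≤ ξ (q + 1) := fun q hq => (hlt q hq).le
      have h₁ := le_of_forall_le_succ hle j.zero_le hj.le
      have h₂ := le_of_forall_le_succ hle (show j + 1 ≤ m by omega) le_rfl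
      exact ⟨⟨by linarith [hxj.1], by linarith [hxj.2]⟩, (haff j hj x hxj).symm⟩

end KLevelGeom
end
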